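/- Summation formula for modified Izergin determinants: let m₁, m₂ ≥ 0 and let ᾱ ∈ ℂ^{m₁}, β̄ ∈ ℂ^{m₂}, γ̄ ∈ ℂ^{m₁+m₂} be tuples such that: the entries of ᾱ are pairwise distinct, the entries of β̄ are pairwise distinct, the entries of γ̄ are pairwise distinct, α_i ≠ γ_k and β_j ≠ γ_k for all indices, α_i ≠ q²β_j for all i,j, and q²β_j ≠ γ_k for all j,k. Then ∑_{I} K^{(l)}_{m₁}(γ̄_I | ᾱ)·K^{(r)}_{m₂}(β̄ | γ̄_{II})·f(γ̄_{II}, γ̄_I) = (−q)^{m₂}·f(β̄, γ̄)·K^{(l)}_{m₁+m₂}(γ̄ | (ᾱ, q²β̄)), where the sum is over all subsets I ⊆ {1,…,m₁+m₂} of size m₁, γ̄_I and γ̄_{II} denote the subtuples of γ̄ indexed by I and its complement (in increasing index order), f(γ̄_{II},γ̄_I) = ∏_{k∈II}∏_{l∈I} f(γ_k,γ_l), f(β̄,γ̄) = ∏_{j}∏_{k} f(β_j,γ_k), and (ᾱ, q²β̄) denotes the concatenated tuple (α₁,…,α_{m₁}, q²β₁,…,q²β_{m₂}). -/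

import Mathlib

open Finset

/-- The function `f(u,v) = (qu - q⁻¹v)/(u - v)`. -/
noncomputable def fF (q u v : ℂ) : ℂ := (q * u - q⁻¹ * v) / (u - v)

/-- The function `g(u,v) = (q - q⁻¹)/(u - v)`. -/
noncomputable def gF (q u v : ℂ) : ℂ := (q - q⁻¹) / (u - v)

/-- The Izergin determinant `K_n(x̄|ȳ)`. -/
noncomputable def Kiz (q : ℂ) {n : ℕ} (x y : Fin n → ℂ) : ℂ :=
  (∏ i : Fin n, ∏ j ∈ Finset.Ioi i, ((x i - x j) * (y j - y i)))⁻¹ *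
    ∑ σ : Equiv.Perm (Fin n), ((Equiv.Perm.sign σ : ℤ) : ℂ) *
      ∏ i : Fin n,
        ((q - q⁻¹) / (x i - y (σ i)) *
          ∏ j ∈ Finset.univ.erase (σ i), (q * x i - q⁻¹ * y j))

/-- The modified Izergin determinant `K^{(l)}_n(x̄|ȳ) = (∏ x_i)·K_n(x̄|ȳ)`. -/
noncomputable def Kl (q : ℂ) {n : ℕ} (x y : Fin n → ℂ) : ℂ := (∏ i, x i) * Kiz q x y

/-- The modified Izergin determinant `K^{(r)}_n(x̄|ȳ) = (∏ y_j)·K_n(x̄|ȳ)`. -/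
noncomputable def Kr (q : ℂ) {n : ℕ} (x y : Fin n → ℂ) : ℂ := (∏ j, y j) * Kiz q x y

/-- The subtuple of `γ` indexed by a finset `I` of cardinality `m`, in increasing
index order. -/
noncomputable def sub {N m : ℕ} (γ : Fin N → ℂ) (I : Finset (Fin N)) (h : I.card = m) :
    Fin m → ℂ :=
  fun k => γ (I.orderIsoOfFin h k : Fin N)

lemma card_compl_of_mem_powersetCard {m₁ m₂ : ℕ}
    (I : {I : Finset (Fin (m₁ + m₂)) // I ∈ Finset.powersetCard m₁ Finset.univ}) :
    I.1ᶜ.card = m₂ := by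
  have h := (Finset.mem_powersetCard.mp I.2).2
  rw [Finset.card_compl, h, Fintype.card_fin]
  omega

/-- The matrix whose determinant is the numerator of the Izergin determinant `K_n(x̄|ȳ)`; rows are
indexed by `y` and columns by `x`. -/
noncomputable def izerginMatrix (q : ℂ) {n : ℕ} (x y : Fin n → ℂ) : Matrix (Fin n) (Fin n) ℂ :=
  Matrix.of fun j i => (q - q⁻¹) / (x i - y j) * ∏ l ∈ univ.erase j, (q * x i - q⁻¹ * y l)

lemma Kiz_eq_det (q : ℂ) {n : ℕ} (x y : Fin n → ℂ) :
    Kiz q x y = ((∏ i, ∏ j ∈ Ioi i, (x i - x j)) * ∏ i, ∏ j ∈ Ioi i, (y j - y i))⁻¹ *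
      (izerginMatrix q x y).det := by
  simp [Kiz, izerginMatrix, Matrix.det_apply', prod_mul_distrib]

lemma prod_univ_erase_eq_prod_succAbove {n : ℕ} (f : Fin (n + 1) → ℂ) (k : Fin (n + 1)) :
    ∏ l ∈ univ.erase k, f l = ∏ l, f (k.succAbove l) := by
  rw [Fin.univ_succAbove n k, erase_cons, prod_map]
  rfl

lemma prod_univ_erase_succ {n : ℕ} (f : Fin (n + 1) → ℂ) (j : Fin n) :
    ∏ l ∈ univ.erase j.succ, f l = f 0 * ∏ l ∈ univ.erase j, f l.succ := by
  have h : univ.erase j.succ = insert 0 ((univ.erase j).map (Fin.succEmb n)) := by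
    ext a
    induction a using Fin.cases <;> simp [(Fin.succ_ne_zero j).symm]
  rw [h, prod_insert (by simp), prod_map]
  rfl

lemma det_izerginMatrix_cons (q : ℂ) {n : ℕ} (x : Fin (n + 1) → ℂ) (t : ℂ) (y : Fin n → ℂ) :
    (izerginMatrix q x (Fin.cons t y)).det =
      ∑ k : Fin (n + 1), (-1) ^ (k : ℕ) *
        ((q - q⁻¹) / (x k - t) * ∏ l, (q * x k - q⁻¹ * y l)) *
        ((∏ l, (q * x (k.succAbove l) - q⁻¹ * t)) *
          (izerginMatrix q (x ∘ k.succAbove) y).det) := by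
  rw [Matrix.det_succ_row_zero]
  refine sum_congr rfl fun k _ => ?_
  congr 1
  · simp [izerginMatrix, prod_univ_erase_eq_prod_succAbove]
  · rw [← Matrix.det_mul_row]
    congr 1
    ext j i
    simp [izerginMatrix, prod_univ_erase_succ]
    ring

lemma det_izerginMatrix_eq_zero (q : ℂ) {n : ℕ} (x y : Fin n → ℂ) {i j : Fin n} (hij : i ≠ j)
    (h : y i = y j) : (izerginMatrix q x y).det = 0 := by
  refine Matrix.det_zero_of_row_eq hij (funext fun k => ?_)
  have key : ∏ l ∈ univ.erase i, (q * x k - q⁻¹ * y l) =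
      ∏ l ∈ univ.erase j, (q * x k - q⁻¹ * y l) := by
    rw [← mul_prod_erase (univ.erase i) _ (mem_erase.mpr ⟨hij.symm, mem_univ j⟩),
      ← mul_prod_erase (univ.erase j) _ (mem_erase.mpr ⟨hij, mem_univ i⟩), erase_right_comm, h]
  simp [izerginMatrix, h, key]

open Polynomial in
lemma eq_of_natDegree_le_of_eval_eq {n : ℕ} (x : Fin (n + 1) → ℂ) (y : Fin n → ℂ)
    (hx : Function.Injective x) (hy : Function.Injective y) (hxy : ∀ i j, x i ≠ y j)
    {p r : ℂ[X]} (hp : p.natDegree ≤ n * 2) (hr : r.natDegree ≤ n * 2)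
    (hpx : ∀ i, p.eval (x i) = r.eval (x i)) (hpy : ∀ j, p.eval (y j) = r.eval (y j)) : p = r := by
  have hlt (s : ℂ[X]) (hs : s.natDegree ≤ n * 2) :
      s.degree < #(univ : Finset (Fin n ⊕ Fin (n + 1))) := by
    refine (degree_le_of_natDegree_le hs).trans_lt ?_
    rw [card_univ, Fintype.card_sum, Fintype.card_fin, Fintype.card_fin]
    exact_mod_cast (by omega)
  refine eq_of_degrees_lt_of_eval_index_eq (v := Sum.elim y x) univ
    (hy.sumElim hx fun j i => (hxy i j).symm).injOn (hlt p hp) (hlt r hr) ?_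
  rintro (j | i) _
  · exact hpy j
  · exact hpx i

open Polynomial in
lemma natDegree_sum_C_mul_prod_le {n : ℕ} (c : Fin (n + 1) → ℂ) (u : Fin (n + 1) → Fin n → ℂ[X])
    (hu : ∀ k l, (u k l).natDegree ≤ 2) :
    (∑ k, C (c k) * ∏ l, u k l).natDegree ≤ n * 2 := by
  refine natDegree_sum_le_of_forall_le _ _ fun k _ => (natDegree_C_mul_le _ _).trans ?_
  refine (natDegree_prod_le _ _).trans ((sum_le_sum fun l _ => hu k l).trans ?_)
  simp

open Polynomial in
lemma det_izerginMatrix_recursion (q : ℂ) {n : ℕ} (x : Fin (n + 1) → ℂ) (t : ℂ) (y : Fin n → ℂ)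
    (hx : Function.Injective x) (hy : Function.Injective y) (hxy : ∀ i j, x i ≠ y j)
    (hxt : ∀ i, x i ≠ t) :
    (izerginMatrix q x (Fin.cons t y)).det =
      ∑ k : Fin (n + 1), (-1) ^ (k : ℕ) * (gF q (x k) t * (∏ l, fF q (x k) (y l)) *
        (∏ l, fF q (x (k.succAbove l)) (x k)) * (izerginMatrix q (x ∘ k.succAbove) y).det) *
        (∏ l, (x (k.succAbove l) - x k)) * ∏ l, (t - y l) := by
  let d (k : Fin (n + 1)) : ℂ := (-1) ^ (k : ℕ) * (q - q⁻¹) *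
    (izerginMatrix q (x ∘ k.succAbove) y).det
  let p : ℂ[X] := ∑ k, C (d k * ∏ l, (q * x k - q⁻¹ * y l)) *
    ∏ l, ((C (x (k.succAbove l)) - X) * (C (q * x (k.succAbove l)) - C q⁻¹ * X))
  let r : ℂ[X] := ∑ k, C (d k) * ∏ l, (C (fF q (x k) (y l) *
    (fF q (x (k.succAbove l)) (x k) * (x (k.succAbove l) - x k))) *
    ((X - C (y l)) * (C (x (k.succAbove l)) - X)))
  have hne (k : Fin (n + 1)) (l : Fin n) : x (k.succAbove l) - x k ≠ 0 :=
    sub_ne_zero.mpr (hx.ne (Fin.succAbove_ne k l))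
  have hp_det (s : ℂ) (hs : ∀ i, x i ≠ s) :
      p.eval s = (∏ i, (x i - s)) * (izerginMatrix q x (Fin.cons s y)).det := by
    rw [det_izerginMatrix_cons, mul_sum]
    simp only [p, eval_finsetSum]
    refine sum_congr rfl fun k _ => ?_
    have := sub_ne_zero.mpr (hs k)
    simp only [eval_mul, eval_C, eval_prod, eval_sub, eval_X, d, prod_mul_distrib,
      Fin.prod_univ_succAbove (fun i => x i - s) k]
    field_simp
  have heq : p = r := by
    refine eq_of_natDegree_le_of_eval_eq x y hx hy hxy ?_ ?_ (fun i => ?_) fun j => ?_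
    · exact natDegree_sum_C_mul_prod_le _ _ fun k l => by compute_degree
    · exact natDegree_sum_C_mul_prod_le _ _ fun k l => by compute_degree
    · simp only [p, r, eval_finsetSum]
      refine sum_congr rfl fun k _ => ?_
      rcases eq_or_ne k i with rfl | hki
      · simp only [eval_mul, eval_C, eval_prod, eval_sub, eval_X, mul_assoc, ← prod_mul_distrib]
        refine congrArg _ (prod_congr rfl fun l _ => ?_)
        have h1 := hne k l
        have h2 := sub_ne_zero.mpr (hxy k l)
        simp only [fF]
        field_simp
      · obtain ⟨l, rfl⟩ := Fin.exists_succAbove_eq hki.symm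
        simp only [eval_mul, eval_prod]
        refine (mul_eq_zero_of_right _ (prod_eq_zero (mem_univ l) ?_)).trans
          (mul_eq_zero_of_right _ (prod_eq_zero (mem_univ l) ?_)).symm <;> simp
    · rw [hp_det _ fun i => hxy i j,
        det_izerginMatrix_eq_zero q x _ (Fin.succ_ne_zero j).symm (by simp)]
      simp only [r, eval_finsetSum]
      rw [mul_zero, eq_comm]
      refine sum_eq_zero fun k _ => ?_
      simp only [eval_mul, eval_prod]
      exact mul_eq_zero_of_right _ (prod_eq_zero (mem_univ j) (by simp))
  have hprod : ∏ i, (x i - t) ≠ 0 := prod_ne_zero_iff.mpr fun i _ => sub_ne_zero.mpr (hxt i)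
  refine mul_left_cancel₀ hprod ?_
  rw [← hp_det t hxt, heq, mul_sum]
  simp only [r, eval_finsetSum]
  refine sum_congr rfl fun k _ => ?_
  have := sub_ne_zero.mpr (hxt k)
  simp only [eval_mul, eval_C, eval_prod, eval_sub, eval_X, d, prod_mul_distrib, gF,
    Fin.prod_univ_succAbove (fun i => x i - t) k]
  field_simp

lemma prod_Ioi_sub_succAbove {n : ℕ} (x : Fin (n + 1) → ℂ) (k : Fin (n + 1)) :
    ∏ i, ∏ j ∈ Ioi i, (x i - x j) = (-1) ^ (k : ℕ) * (∏ l, (x k - x (k.succAbove l))) *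
      ∏ i, ∏ j ∈ Ioi i, (x (k.succAbove i) - x (k.succAbove j)) := by
  have hperm := Matrix.det_permute k.cycleRange.symm (Matrix.vandermonde fun i => -x i)
  have hsub : (Matrix.vandermonde fun i => -x i).submatrix k.cycleRange.symm id =
      Matrix.vandermonde fun i => -x (k.cycleRange.symm i) := rfl
  rw [hsub, Matrix.det_vandermonde, Matrix.det_vandermonde, Equiv.Perm.sign_symm,
    Fin.sign_cycleRange, Fin.prod_univ_succ, Fin.prod_Ioi_zero] at hperm
  simp only [Fin.prod_Ioi_succ, Fin.cycleRange_symm_zero, Fin.cycleRange_symm_succ,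
    neg_sub_neg] at hperm
  rw [mul_assoc, hperm, ← mul_assoc]
  simp [← mul_pow]

lemma Kiz_recursion (q : ℂ) {n : ℕ} (x y : Fin (n + 1) → ℂ)
    (hx : Function.Injective x) (hy : Function.Injective y) (hxy : ∀ i j, x i ≠ y j) :
    Kiz q x y = ∑ k : Fin (n + 1), gF q (x k) (y 0) * (∏ l : Fin n, fF q (x k) (y l.succ)) *
      (∏ l, fF q (x (k.succAbove l)) (x k)) * Kiz q (x ∘ k.succAbove) (y ∘ Fin.succ) := by
  have hdet := det_izerginMatrix_recursion q x (y 0) (Fin.tail y) hx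
    (hy.comp (Fin.succ_injective n)) (fun i j => hxy i j.succ) (fun i => hxy i 0)
  rw [Fin.cons_self_tail] at hdet
  rw [Kiz_eq_det, hdet, mul_sum]
  refine sum_congr rfl fun k _ => ?_
  rw [Kiz_eq_det, prod_Ioi_sub_succAbove x k, Fin.prod_univ_succ
    (fun i => ∏ j ∈ Ioi i, (y j - y i)),
    Fin.prod_Ioi_zero]
  simp only [Fin.prod_Ioi_succ, Function.comp_apply, Fin.tail]
  have h1 : ∏ l, (x k - x (k.succAbove l)) ≠ 0 :=
    prod_ne_zero_iff.mpr fun l _ => sub_ne_zero.mpr (hx.ne (Fin.succAbove_ne k l).symm)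
  have h2 : ∏ l : Fin n, (y l.succ - y 0) ≠ 0 :=
    prod_ne_zero_iff.mpr fun l _ => sub_ne_zero.mpr (hy.ne (Fin.succ_ne_zero l))
  have h3 : (∏ l, (x (k.succAbove l) - x k)) * ∏ l : Fin n, (y 0 - y l.succ) =
      (∏ l, (x k - x (k.succAbove l))) * ∏ l : Fin n, (y l.succ - y 0) := by
    rw [← prod_mul_distrib, ← prod_mul_distrib]
    exact prod_congr rfl fun l _ => by ring
  have h4 : ((-1 : ℂ) ^ (k : ℕ)) ≠ 0 := by simp
  rw [mul_assoc _ (∏ l, (x (k.succAbove l) - x k)), h3]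
  simp only [mul_inv]
  field_simp
  rfl

/-- The Izergin determinant `K(γ̄_I|ȳ)` of a subtuple of `γ`, computed by recursion on the list of
second arguments. -/
noncomputable def izerginRec (q : ℂ) {ι : Type*} [DecidableEq ι] (γ : ι → ℂ) :
    List ℂ → Finset ι → ℂ
  | [], _ => 1
  | a :: s, I => ∑ k ∈ I, gF q (γ k) a * (s.map (fF q (γ k))).prod *
      (∏ l ∈ I.erase k, fF q (γ l) (γ k)) * izerginRec q γ s (I.erase k)

lemma izerginRec_map (q : ℂ) {ι κ : Type*} [DecidableEq ι] [DecidableEq κ] (e : κ ↪ ι)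
    (γ : ι → ℂ) (s : List ℂ) (I : Finset κ) :
    izerginRec q γ s (I.map e) = izerginRec q (γ ∘ e) s I := by
  induction s generalizing I with
  | nil => rfl
  | cons a s ih => simp [izerginRec, ← map_erase, ih]

lemma sum_powersetCard_succ_sum {ι : Type*} [DecidableEq ι] (m : ℕ) (I : Finset ι)
    (F : ι → Finset ι → ℂ) :
    ∑ J ∈ powersetCard (m + 1) I, ∑ k ∈ J, F k (J.erase k) =
      ∑ k ∈ I, ∑ J ∈ powersetCard m (I.erase k), F k J := by
  rw [sum_sigma', sum_sigma']
  refine sum_bij' (fun p _ => ⟨p.2, p.1.erase p.2⟩)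
    (fun p _ => ⟨insert p.1 p.2, p.1⟩) ?_ ?_ ?_ ?_ ?_
  · rintro ⟨J, k⟩ h
    simp only [mem_sigma, mem_powersetCard] at h ⊢
    refine ⟨h.1.1 h.2, erase_subset_erase k h.1.1, ?_⟩
    rw [card_erase_of_mem h.2, h.1.2, Nat.add_sub_cancel]
  · rintro ⟨k, J⟩ h
    simp only [mem_sigma, mem_powersetCard] at h ⊢
    have hk : k ∉ J := fun hk => by simpa using h.2.1 hk
    refine ⟨⟨insert_subset h.1 (h.2.1.trans (erase_subset k I)), ?_⟩, mem_insert_self k J⟩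
    rw [card_insert_of_notMem hk, h.2.2]
  · rintro ⟨J, k⟩ h
    simp only [mem_sigma] at h
    simp [insert_erase h.2]
  · rintro ⟨k, J⟩ h
    simp only [mem_sigma, mem_powersetCard] at h
    have hk : k ∉ J := fun hk => by simpa using h.2.1 hk
    simp [erase_insert hk]
  · intros
    rfl

lemma izerginRec_append (q : ℂ) {ι : Type*} [DecidableEq ι] (γ : ι → ℂ) (s s' : List ℂ)
    (h : ι → ℂ) (hh : ∀ k, (s'.map (fF q (γ k))).prod * h k = 1) (I : Finset ι) :
    ∑ J ∈ powersetCard s.length I, izerginRec q γ s J *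
        (izerginRec q γ s' (I \ J) * ∏ k ∈ I \ J, h k) * ∏ k ∈ I \ J, ∏ l ∈ J, fF q (γ k) (γ l) =
      izerginRec q γ (s ++ s') I * ∏ k ∈ I, h k := by
  induction s generalizing I with
  | nil => simp [izerginRec]
  | cons a s ih =>
    let F (k : ι) (J : Finset ι) : ℂ := gF q (γ k) a * (s.map (fF q (γ k))).prod *
      (∏ l ∈ I.erase k, fF q (γ l) (γ k)) * (izerginRec q γ s J *
        (izerginRec q γ s' (I.erase k \ J) * ∏ k ∈ I.erase k \ J, h k) *
          ∏ i ∈ I.erase k \ J, ∏ l ∈ J, fF q (γ i) (γ l))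
    calc _ = ∑ J ∈ powersetCard (s.length + 1) I, ∑ k ∈ J, F k (J.erase k) := by
          refine sum_congr rfl fun J hJ => ?_
          simp only [izerginRec, sum_mul]
          refine sum_congr rfl fun k hk => ?_
          have hJI := (mem_powersetCard.mp hJ).1
          have hsd : I.erase k \ J.erase k = I \ J := by
            ext i
            simp only [mem_sdiff, mem_erase]
            grind
          have hsplit : ∏ l ∈ I.erase k, fF q (γ l) (γ k) =
              (∏ l ∈ I \ J, fF q (γ l) (γ k)) * ∏ l ∈ J.erase k, fF q (γ l) (γ k) := by
            rw [← hsd, prod_sdiff (erase_subset_erase k hJI)]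
          have hrow : ∏ i ∈ I \ J, ∏ l ∈ J, fF q (γ i) (γ l) =
              (∏ l ∈ I \ J, fF q (γ l) (γ k)) * ∏ i ∈ I \ J, ∏ l ∈ J.erase k, fF q (γ i) (γ l) := by
            rw [← prod_mul_distrib]
            exact prod_congr rfl fun i _ => (mul_prod_erase J _ hk).symm
          simp only [F, hsd, hsplit, hrow]
          ring
      _ = _ := by
          rw [sum_powersetCard_succ_sum]
          simp only [F, ← mul_sum, ih, List.cons_append, izerginRec, sum_mul]
          refine sum_congr rfl fun k hk => ?_
          rw [← mul_prod_erase I h hk, List.map_append, List.prod_append]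
          linear_combination -(gF q (γ k) a * (s.map (fF q (γ k))).prod *
            (∏ l ∈ I.erase k, fF q (γ l) (γ k)) * (izerginRec q γ (s ++ s') (I.erase k) *
            ∏ k ∈ I.erase k, h k)) * hh k

lemma Kiz_eq_izerginRec (q : ℂ) {n : ℕ} (x y : Fin n → ℂ)
    (hx : Function.Injective x) (hy : Function.Injective y) (hxy : ∀ i j, x i ≠ y j) :
    Kiz q x y = izerginRec q x (List.ofFn y) univ := by
  induction n with
  | zero => simp [Kiz, izerginRec]
  | succ n ih =>
    rw [Kiz_recursion q x y hx hy hxy, List.ofFn_succ, izerginRec]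
    refine sum_congr rfl fun k _ => ?_
    have hk : univ.erase k = univ.map k.succAboveEmb := by
      rw [Fin.univ_succAbove n k, erase_cons]
    rw [ih _ _ (hx.comp Fin.succAbove_right_injective) (hy.comp (Fin.succ_injective n))
      fun i j => hxy _ _, hk, izerginRec_map, prod_map, List.map_ofFn, List.prod_ofFn]
    rfl

lemma Kiz_sub_eq_izerginRec (q : ℂ) {N m : ℕ} (γ : Fin N → ℂ) (I : Finset (Fin N))
    (h : #I = m) (y : Fin m → ℂ) (hγ : Function.Injective γ) (hy : Function.Injective y)
    (hγy : ∀ k j, γ k ≠ y j) :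
    Kiz q (sub γ I h) y = izerginRec q γ (List.ofFn y) I := by
  have hsub : sub γ I h = γ ∘ (I.orderEmbOfFin h).toEmbedding := rfl
  rw [hsub, Kiz_eq_izerginRec q _ y (hγ.comp (I.orderEmbOfFin h).toEmbedding.injective) hy
    fun i j => hγy _ j, ← izerginRec_map, map_orderEmbOfFin_univ]

lemma prod_sub_comp {N m : ℕ} (γ : Fin N → ℂ) (I : Finset (Fin N)) (h : #I = m) (u : ℂ → ℂ) :
    ∏ i, u (sub γ I h i) = ∏ k ∈ I, u (γ k) := by
  conv_rhs => rw [← map_orderEmbOfFin_univ I h, prod_map]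
  rfl

lemma prod_sub {N m : ℕ} (γ : Fin N → ℂ) (I : Finset (Fin N)) (h : #I = m) :
    ∏ i, sub γ I h i = ∏ k ∈ I, γ k :=
  prod_sub_comp γ I h id

lemma pow_mul_prod_Ioi_sq (q : ℂ) (m : ℕ) :
    q ^ m * ∏ i : Fin m, ∏ _j ∈ Ioi i, q ^ 2 = q ^ (m * m) := by
  induction m with
  | zero => simp
  | succ m ih =>
    simp only [Fin.prod_univ_succ, Fin.prod_Ioi_zero, Fin.prod_Ioi_succ]
    rw [show (m + 1) * (m + 1) = m * m + (2 * m + 1) by ring, pow_add q (m * m), ← ih]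
    simp only [prod_const, card_univ, Fintype.card_fin]
    ring

/-- Exchanging the two groups of arguments of the Izergin determinant. -/
lemma Kiz_swap (q : ℂ) (hq : q ≠ 0) {m : ℕ} (x y : Fin m → ℂ) (hxy : ∀ i j, x i ≠ y j)
    (hxy2 : ∀ i j, q ^ 2 * x i ≠ y j) :
    Kiz q x y = (-q) ^ m * (∏ i, ∏ j, fF q (x i) (y j)) * Kiz q y (fun i => q ^ 2 * x i) := by
  have h1 (i j) : y j - x i ≠ 0 := sub_ne_zero.mpr (hxy i j).symm
  have h1' (i j) : x i - y j ≠ 0 := sub_ne_zero.mpr (hxy i j)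
  have h2 (i j) : y j - q ^ 2 * x i ≠ 0 := sub_ne_zero.mpr (hxy2 i j).symm
  have hP (i j) : q * x i - q⁻¹ * y j = -q⁻¹ * (y j - q ^ 2 * x i) := by
    field_simp
    ring
  have hQ (j i) : q * y j - q⁻¹ * (q ^ 2 * x i) = q * (y j - x i) := by
    field_simp
  let P (i : Fin m) : ℂ := ∏ j, (q * x i - q⁻¹ * y j)
  let Q (j : Fin m) : ℂ := ∏ i, (q * y j - q⁻¹ * (q ^ 2 * x i))
  have hQ0 (j) : Q j ≠ 0 := prod_ne_zero_iff.mpr fun i _ => by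
    rw [hQ]
    exact mul_ne_zero hq (h1 i j)
  have hdet : (izerginMatrix q x y).det =
      (∏ i, P i * q ^ 2) * ((∏ j, (Q j)⁻¹) * (izerginMatrix q y fun i => q ^ 2 * x i).det) := by
    rw [← Matrix.det_transpose (izerginMatrix q y _), ← Matrix.det_mul_column,
      ← Matrix.det_mul_row]
    congr 1
    ext j i
    have e1 : P i = _ := (mul_prod_erase univ _ (mem_univ j)).symm
    have e2 : Q j = _ := (mul_prod_erase univ _ (mem_univ i)).symm
    have e3 := hQ0 j
    simp only [izerginMatrix, Matrix.of_apply, Matrix.transpose_apply]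
    rw [e2, hQ] at e3
    have := right_ne_zero_of_mul e3
    rw [e1, e2, hP, hQ]
    have := h1 i j
    have := h1' i j
    have := h2 i j
    generalize ∏ l ∈ univ.erase j, (q * x i - q⁻¹ * y l) = A
    generalize ∏ l ∈ univ.erase i, (q * y j - q⁻¹ * (q ^ 2 * x l)) = B at *
    field_simp
    ring
  have hPQ : (-q) ^ (m * m) * ∏ i, P i = (∏ j, Q j) * ∏ i, ∏ j, fF q (x i) (y j) := by
    have hconst : (-q) ^ (m * m) = ∏ _i : Fin m, ∏ _j : Fin m, (-q) := by simp [pow_mul]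
    simp only [P, Q, hconst]
    rw [prod_comm (f := fun j i => q * y j - q⁻¹ * (q ^ 2 * x i))]
    simp only [← prod_mul_distrib]
    refine prod_congr rfl fun i _ => prod_congr rfl fun j _ => ?_
    rw [hQ, fF]
    have := h1' i j
    field_simp
    ring
  have hden : (∏ i, ∏ j ∈ Ioi i, (y i - y j)) * ∏ i, ∏ j ∈ Ioi i, (q ^ 2 * x j - q ^ 2 * x i) =
      (∏ i : Fin m, ∏ _j ∈ Ioi i, q ^ 2) *
        ((∏ i, ∏ j ∈ Ioi i, (x i - x j)) * ∏ i, ∏ j ∈ Ioi i, (y j - y i)) := by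
    simp only [← prod_mul_distrib]
    exact prod_congr rfl fun i _ => prod_congr rfl fun j _ => by ring
  have hsign : (-q) ^ (m * m) = (-1) ^ m * (q ^ m * ∏ i : Fin m, ∏ _j ∈ Ioi i, q ^ 2) := by
    rw [pow_mul_prod_Ioi_sq, neg_pow, pow_mul]
    rcases Nat.even_or_odd m with hm | hm <;> simp [hm.neg_one_pow]
  have hE : ∏ i : Fin m, ∏ _j ∈ Ioi i, q ^ 2 ≠ 0 :=
    prod_ne_zero_iff.mpr fun i _ => prod_ne_zero_iff.mpr fun j _ => pow_ne_zero 2 hq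
  have hQprod : ∏ j, Q j ≠ 0 := prod_ne_zero_iff.mpr fun j _ => hQ0 j
  have hunit : ((-1 : ℂ) ^ m) * (-1) ^ m = 1 := by simp [← mul_pow]
  have hcoef : (∏ i, P i * q ^ 2) * (∏ j, (Q j)⁻¹) =
      (-q) ^ m * (∏ i, ∏ j, fF q (x i) (y j)) * (∏ i : Fin m, ∏ _j ∈ Ioi i, q ^ 2)⁻¹ := by
    rw [hsign] at hPQ
    rw [prod_mul_distrib, prod_inv_distrib, prod_const, card_univ, Fintype.card_fin, neg_pow]
    field_simp
    linear_combination (-1) ^ m * q ^ m * hPQ -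
      q ^ m * q ^ m * (∏ i, P i) * (∏ i : Fin m, ∏ _j ∈ Ioi i, q ^ 2) * hunit
  rw [Kiz_eq_det, Kiz_eq_det, hdet, hden, mul_inv (∏ i : Fin m, ∏ _j ∈ Ioi i, q ^ 2)]
  linear_combination ((∏ i, ∏ j ∈ Ioi i, (x i - x j)) * ∏ i, ∏ j ∈ Ioi i, (y j - y i))⁻¹ *
    (izerginMatrix q y fun i => q ^ 2 * x i).det * hcoef

/-- Summation formula for the modified Izergin determinants. -/
theorem izergin_summation_modified (q : ℂ) (hq : q ≠ 0) (hq2 : q ^ 2 ≠ 1)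
    (m₁ m₂ : ℕ) (α : Fin m₁ → ℂ) (β : Fin m₂ → ℂ) (γ : Fin (m₁ + m₂) → ℂ)
    (hα : Function.Injective α) (hβ : Function.Injective β) (hγ : Function.Injective γ)
    (hαγ : ∀ i k, α i ≠ γ k) (hβγ : ∀ j k, β j ≠ γ k)
    (hαβ : ∀ i j, α i ≠ q ^ 2 * β j)
    (hβγ2 : ∀ j k, q ^ 2 * β j ≠ γ k) :
    ∑ I ∈ (Finset.powersetCard m₁ (Finset.univ : Finset (Fin (m₁ + m₂)))).attach,
        Kl q (sub γ I.1 (Finset.mem_powersetCard.mp I.2).2) α *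
          Kr q β (sub γ I.1ᶜ (card_compl_of_mem_powersetCard I)) *
          ∏ k ∈ I.1ᶜ, ∏ l ∈ I.1, fF q (γ k) (γ l)
      = (-q) ^ m₂ * (∏ j, ∏ k, fF q (β j) (γ k)) *
          Kl q γ (Fin.append α (fun j => q ^ 2 * β j)) := by
  have hf (k) (j) : fF q (γ k) (q ^ 2 * β j) * fF q (β j) (γ k) = 1 := by
    have h1 := sub_ne_zero.mpr (hβγ j k)
    have h2 := sub_ne_zero.mpr (hβγ2 j k).symm
    have h3 : q * β j - q⁻¹ * γ k = -q⁻¹ * (γ k - q ^ 2 * β j) := by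
      field_simp
      ring
    rw [fF, fF, h3]
    field_simp
    ring
  have hq2β : Function.Injective fun j => q ^ 2 * β j :=
    (mul_right_injective₀ (pow_ne_zero 2 hq)).comp hβ
  have happ : Function.Injective (Fin.append α fun j => q ^ 2 * β j) :=
    Fin.append_injective_iff.mpr ⟨hα, hq2β, hαβ⟩
  have hγapp (k i) : γ k ≠ Fin.append α (fun j => q ^ 2 * β j) i := by
    induction i using Fin.addCases with
    | left i => simpa using (hαγ i k).symm
    | right j => simpa using (hβγ2 j k).symm
  have key := izerginRec_append q γ (List.ofFn α) (List.ofFn fun j => q ^ 2 * β j)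
    (fun k => ∏ j, fF q (β j) (γ k))
    (fun k => by simp [List.map_ofFn, List.prod_ofFn, ← prod_mul_distrib, hf]) univ
  rw [List.length_ofFn, ← List.ofFn_fin_append, ← Kiz_eq_izerginRec q γ _ hγ happ hγapp] at key
  rw [Kl, prod_comm (f := fun j k => fF q (β j) (γ k))]
  calc _ = ∑ I ∈ (powersetCard m₁ (univ : Finset (Fin (m₁ + m₂)))).attach,
        (-q) ^ m₂ * (∏ k, γ k) * (izerginRec q γ (List.ofFn α) I.1 *
        (izerginRec q γ (List.ofFn fun j => q ^ 2 * β j) (univ \ I.1) *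
          ∏ k ∈ univ \ I.1, ∏ j, fF q (β j) (γ k)) *
            ∏ k ∈ univ \ I.1, ∏ l ∈ I.1, fF q (γ k) (γ l)) := by
        refine sum_congr rfl fun I _ => ?_
        rw [Kl, Kr, Kiz_swap q hq β (sub γ I.1ᶜ _) (fun i j => hβγ i _) (fun i j => hβγ2 i _),
          Kiz_sub_eq_izerginRec q γ _ _ _ hγ hα fun k i => (hαγ i k).symm,
          Kiz_sub_eq_izerginRec q γ _ _ _ hγ hq2β fun k j => (hβγ2 j k).symm,
          prod_sub γ I.1, prod_sub γ I.1ᶜ, prod_comm (s := univ) (t := univ),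
          prod_sub_comp γ I.1ᶜ _ fun u => ∏ j, fF q (β j) u, ← prod_mul_prod_compl I.1 γ,
          compl_eq_univ_sdiff]
        ring
    _ = _ := by
        rw [← mul_sum, sum_attach (powersetCard m₁ univ) fun I => izerginRec q γ (List.ofFn α) I *
          (izerginRec q γ (List.ofFn fun j => q ^ 2 * β j) (univ \ I) *
            ∏ k ∈ univ \ I, ∏ j, fF q (β j) (γ k)) *
              ∏ k ∈ univ \ I, ∏ l ∈ I, fF q (γ k) (γ l), key]
        ring
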